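/- arXiv:2407.19223 — 7 statements merged into one kernel-verified Lean document; each statement's English description precedes it below -/
import Mathlib

section
/- For every integer n ≥ 2 and every integer ν, C_n(ν + 1) = C_n(ν) − 2·cot((2ν + 1)π/(2n)). (Note that (2ν+1)π/(2n) is never an integer multiple of π, so the cotangent is well defined.) -/
open Real Finset

/-- `C n ν = Σ_{l=1}^{n-1} cos(2πνl/n) · csc(πl/n)`. -/
noncomputable def C (n : ℕ) (ν : ℤ) : ℝ :=
  ∑ l ∈ Finset.Icc 1 (n - 1), Real.cos (2 * π * ν * l / n) / Real.sin (π * l / n)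

theorem two_mul_sin_mul_sum_sin (θ : ℝ) (m : ℕ) :
    2 * Real.sin θ * ∑ l ∈ Finset.Icc 1 m, Real.sin (2 * l * θ) =
      Real.cos θ - Real.cos ((2 * m + 1) * θ) := by
  induction m with
  | zero => simp
  | succ m ih =>
    rw [Finset.sum_Icc_succ_top (by omega), mul_add, ih]
    push_cast
    have h₁ : (2 * (m : ℝ) + 1) * θ = 2 * (m + 1) * θ - θ := by ring
    have h₂ : (2 * ((m : ℝ) + 1) + 1) * θ = 2 * (m + 1) * θ + θ := by ring
    rw [h₁, h₂, Real.cos_sub, Real.cos_add]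
    ring

theorem sin_odd_mul_pi_div_ne_zero {n : ℕ} (hn : n ≠ 0) (ν : ℤ) :
    Real.sin ((2 * ν + 1) * π / (2 * n)) ≠ 0 := by
  rw [Real.sin_ne_zero_iff]
  intro k hk
  have hn' : (n : ℝ) ≠ 0 := by exact_mod_cast hn
  field_simp at hk
  have hk' : k * 2 * (n : ℤ) = 2 * ν + 1 := by
    exact_mod_cast (show (k : ℝ) * 2 * n = 2 * ν + 1 by linarith)
  have : 2 * (k * n) = 2 * ν + 1 := by linarith
  omega

theorem sum_sin_odd_mul_pi_div {n : ℕ} (hn : n ≠ 0) (ν : ℤ) :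
    ∑ l ∈ Finset.Icc 1 (n - 1), Real.sin (2 * l * ((2 * ν + 1) * π / (2 * n))) =
      Real.cot ((2 * ν + 1) * π / (2 * n)) := by
  have hs := sin_odd_mul_pi_div_ne_zero hn ν
  have h := two_mul_sin_mul_sum_sin ((2 * ν + 1) * π / (2 * n)) (n - 1)
  have hn' : (n : ℝ) ≠ 0 := by exact_mod_cast hn
  have hlast : (2 * ((n - 1 : ℕ) : ℝ) + 1) * ((2 * ν + 1) * π / (2 * n)) =
      π - (2 * ν + 1) * π / (2 * n) + ν * (2 * π) := by
    rw [Nat.cast_pred (Nat.pos_of_ne_zero hn)]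
    field_simp
    ring
  rw [hlast, Real.cos_add_int_mul_two_pi, Real.cos_pi_sub] at h
  rw [Real.cot_eq_cos_div_sin, eq_div_iff hs]
  linarith

theorem sin_pi_mul_div_ne_zero {n l : ℕ} (hl : 0 < l) (hln : l < n) :
    Real.sin (π * l / n) ≠ 0 := by
  have hl' : (0 : ℝ) < l := by exact_mod_cast hl
  have hn' : (0 : ℝ) < n := by exact_mod_cast hl.trans hln
  have hln' : (l : ℝ) < n := by exact_mod_cast hln
  refine (Real.sin_pos_of_pos_of_lt_pi (by positivity) ?_).ne'
  rw [div_lt_iff₀ hn']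
  exact mul_lt_mul_of_pos_left hln' Real.pi_pos

theorem C_rec (n : ℕ) (hn : 2 ≤ n) (ν : ℤ) :
    C n (ν + 1) = C n ν - 2 * Real.cot ((2 * ν + 1) * π / (2 * n)) := by
  have hn₀ : n ≠ 0 := by omega
  rw [← sum_sin_odd_mul_pi_div hn₀ ν, C, C, Finset.mul_sum, ← Finset.sum_sub_distrib]
  refine Finset.sum_congr rfl fun l hl => ?_
  rw [Finset.mem_Icc] at hl
  have hs := sin_pi_mul_div_ne_zero (n := n) (l := l) (by omega) (by omega)
  have hn' : (n : ℝ) ≠ 0 := by exact_mod_cast hn₀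
  rw [div_eq_iff hs, sub_mul, div_mul_cancel₀ _ hs]
  have h₁ : 2 * π * ((ν + 1 : ℤ) : ℝ) * l / n =
      2 * l * ((2 * ν + 1) * π / (2 * n)) + π * l / n := by
    push_cast
    field_simp
    ring
  have h₂ : 2 * π * (ν : ℝ) * l / n =
      2 * l * ((2 * ν + 1) * π / (2 * n)) - π * l / n := by
    field_simp
    ring
  rw [h₁, h₂, Real.cos_add, Real.cos_sub]
  ring
end

section
/- For every integer n ≥ 2, Σ_{ν=1}^{n−1} ν·C_n(ν) = −n·S_n/2. -/
open Real Finset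

/-- Watson's sum `S n = Σ_{l=1}^{n-1} csc(πl/n)`. -/
noncomputable def S (n : ℕ) : ℝ :=
  ∑ l ∈ Finset.Icc 1 (n - 1), 1 / Real.sin (π * l / n)

/-- Closed form of `∑ ν < m, ν cos (2νx)`, cleared of the denominator `4 sin² x`. -/
theorem sum_range_mul_cos (x : ℝ) (m : ℕ) :
    (∑ ν ∈ Finset.range m, (ν : ℝ) * Real.cos (2 * ν * x)) * (4 * Real.sin x ^ 2) =
      2 * m * Real.sin x * Real.sin (2 * m * x - x) + Real.cos (2 * m * x) - 1 := by
  induction m with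
  | zero => simp
  | succ m ih =>
    rw [Finset.sum_range_succ, add_mul, ih]
    push_cast
    have h₁ : 2 * ((m : ℝ) + 1) * x - x = 2 * m * x + x := by ring
    have h₂ : 2 * ((m : ℝ) + 1) * x = 2 * m * x + 2 * x := by ring
    rw [h₁, h₂, Real.sin_sub, Real.sin_add, Real.cos_add (2 * m * x) (2 * x), Real.sin_two_mul,
      Real.cos_two_mul, Real.cos_sq']
    ring

theorem sum_mul_cos_eq_neg_half (n l : ℕ) (hl : 0 < l) (hln : l < n) :
    ∑ ν ∈ Finset.Icc 1 (n - 1), (ν : ℝ) * Real.cos (2 * ν * (π * l / n)) = -(n : ℝ) / 2 := by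
  have hl' : (0 : ℝ) < l := by exact_mod_cast hl
  have hln' : (l : ℝ) < n := by exact_mod_cast hln
  have hn : (0 : ℝ) < n := hl'.trans hln'
  have hsin : 0 < Real.sin (π * l / n) := by
    apply Real.sin_pos_of_pos_of_lt_pi
    · positivity
    · rw [div_lt_iff₀ hn]
      exact mul_lt_mul_of_pos_left hln' Real.pi_pos
  have hsum := sum_range_mul_cos (π * l / n) n
  have hperiod : 2 * (n : ℝ) * (π * l / n) = l * (2 * π) := by
    field_simp
  rw [hperiod, Real.sin_nat_mul_two_pi_sub, Real.cos_nat_mul_two_pi] at hsum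
  have hrange : ∑ ν ∈ Finset.Icc 1 (n - 1), (ν : ℝ) * Real.cos (2 * ν * (π * l / n)) =
      ∑ ν ∈ Finset.range n, (ν : ℝ) * Real.cos (2 * ν * (π * l / n)) := by
    apply Finset.sum_subset
    · intro ν hν
      rw [Finset.mem_Icc] at hν
      rw [Finset.mem_range]
      omega
    · intro ν hν hν'
      rw [Finset.mem_range] at hν
      rw [Finset.mem_Icc] at hν'
      obtain rfl : ν = 0 := by omega
      simp
  rw [hrange]
  apply mul_right_cancel₀ (b := 4 * Real.sin (π * l / n) ^ 2) (by positivity)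
  rw [hsum]
  ring

theorem sum_nu_C (n : ℕ) (hn : 2 ≤ n) :
    ∑ ν ∈ Finset.Icc 1 (n - 1), (ν : ℝ) * C n (ν : ℤ) = - ((n : ℝ) * S n) / 2 := by
  simp only [C, S, Finset.mul_sum]
  rw [Finset.sum_comm, ← Finset.sum_neg_distrib, Finset.sum_div]
  refine Finset.sum_congr rfl fun l hl => ?_
  rw [Finset.mem_Icc] at hl
  have h := sum_mul_cos_eq_neg_half n l (by omega) (by omega)
  calc
    _ = (∑ ν ∈ Finset.Icc 1 (n - 1), (ν : ℝ) * Real.cos (2 * ν * (π * l / n))) /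
        Real.sin (π * l / n) := by
      rw [Finset.sum_div]
      refine Finset.sum_congr rfl fun ν _ => ?_
      rw [Int.cast_natCast, ← mul_div_assoc,
        show 2 * π * (ν : ℝ) * l / n = 2 * ν * (π * l / n) by ring]
    _ = _ := by
      rw [h]
      ring
end

section
/- For every integer n ≥ 2, Σ_{ν=1}^{n−1} C_n(ν)·ln(sin(πν/n)) = (γ + ln(2n))·S_n + Σ_{r=1}^{n−1} Ψ(r/n)·csc(πr/n). -/
open Real Finset

/-- The digamma function `Ψ = Γ'/Γ`. -/
noncomputable def digamma (x : ℝ) : ℝ := deriv Real.Gamma x / Real.Gamma x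

open Filter Topology

/-- The logarithmic series converges to `-log (1 - z)` on the unit circle away from `1`. -/
lemma Complex.tendsto_sum_pow_div_of_norm_eq_one {z : ℂ} (hz : ‖z‖ = 1) (h1 : z ≠ 1) :
    Tendsto (fun N : ℕ ↦ ∑ i ∈ range N, z ^ i / i) atTop (𝓝 (-Complex.log (1 - z))) := by
  have hre : z.re < 1 := by
    refine lt_of_le_of_ne (hz ▸ Complex.re_le_norm z) fun h ↦ h1 ?_
    have := Complex.sq_norm z
    rw [hz, Complex.normSq_apply, h] at this
    exact Complex.ext h (by simpa using this)
  have hcauchy : CauchySeq fun N : ℕ ↦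
      ∑ i ∈ range N, (1 / ((i : ℝ) + 1)) • z ^ (i + 1) := by
    refine Antitone.cauchySeq_series_mul_of_tendsto_zero_of_bounded (b := 2 / ‖z - 1‖)
      (fun a b hab ↦ by gcongr) tendsto_one_div_add_atTop_nhds_zero_nat fun N ↦ ?_
    simp_rw [pow_succ']
    rw [← mul_sum, geom_sum_eq h1, norm_mul, hz, one_mul, norm_div]
    gcongr
    calc ‖z ^ N - 1‖ ≤ ‖z ^ N‖ + ‖(1 : ℂ)‖ := norm_sub_le _ _
      _ = 2 := by rw [norm_pow, hz]; norm_num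
  obtain ⟨l, hl⟩ := cauchySeq_tendsto_of_complete hcauchy
  have hl' : Tendsto (fun N : ℕ ↦ ∑ i ∈ range N, z ^ i / i) atTop (𝓝 l) := by
    rw [← tendsto_add_atTop_iff_nat 1]
    refine hl.congr fun N ↦ ?_
    rw [sum_range_succ']
    simp [div_eq_inv_mul]
  have habel := Complex.tendsto_tsum_powerSeries_nhdsWithin_lt hl'
  rw [tendsto_map'_iff] at habel
  have hlog : Tendsto (fun x : ℝ ↦ -Complex.log (1 - z * x)) (𝓝[<] 1)
      (𝓝 (-Complex.log (1 - z))) := by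
    have : ContinuousAt (fun x : ℝ ↦ -Complex.log (1 - z * x)) 1 := by
      refine ContinuousAt.neg (ContinuousAt.clog (by fun_prop) (Or.inl ?_))
      simpa using hre
    simpa [ContinuousAt] using this.tendsto.mono_left nhdsWithin_le_nhds
  have heq : l = -Complex.log (1 - z) := by
    refine tendsto_nhds_unique (habel.congr' ?_) hlog
    filter_upwards [Ioo_mem_nhdsLT (show (0 : ℝ) < 1 by norm_num)] with x hx
    have hlt : ‖z * x‖ < 1 := by
      rw [norm_mul, hz, one_mul, Complex.norm_real, Real.norm_eq_abs, abs_of_pos hx.1]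
      exact hx.2
    rw [← (Complex.hasSum_taylorSeries_neg_log hlt).tsum_eq]
    simp only [Function.comp_apply, mul_pow]
    exact tsum_congr fun n ↦ by ring
  exact heq ▸ hl'

/-- The Fourier series of `log (2 sin θ)` converges pointwise on `(0, π)`. -/
lemma Real.tendsto_sum_cos_div {θ : ℝ} (h0 : 0 < θ) (hπ : θ < π) :
    Tendsto (fun N : ℕ ↦ ∑ i ∈ range N, cos (2 * i * θ) / i) atTop
      (𝓝 (-log (2 * sin θ))) := by
  have hsin := sin_pos_of_pos_of_lt_pi h0 hπ
  have hnorm : ‖Complex.exp (Complex.I * (2 * θ : ℝ)) - 1‖ = 2 * sin θ := by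
    rw [Complex.norm_exp_I_mul_ofReal_sub_one, mul_div_cancel_left₀ θ two_ne_zero,
      Real.norm_eq_abs, abs_of_pos (by positivity)]
  have hne : Complex.exp (Complex.I * (2 * θ : ℝ)) ≠ 1 := fun h ↦ by
    rw [h, sub_self, norm_zero] at hnorm
    linarith
  have h := (Complex.continuous_re.tendsto _).comp
    (Complex.tendsto_sum_pow_div_of_norm_eq_one (Complex.norm_exp_I_mul_ofReal _) hne)
  rw [Complex.neg_re, Complex.log_re, norm_sub_rev, hnorm] at h
  refine h.congr fun N ↦ ?_
  simp only [Function.comp_apply, Complex.re_sum]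
  refine sum_congr rfl fun i _ ↦ ?_
  rw [← Complex.exp_nat_mul, Complex.div_natCast_re,
    show (i : ℂ) * (Complex.I * (2 * θ : ℝ)) = ((2 * i * θ : ℝ) : ℂ) * Complex.I by
      push_cast; ring, Complex.exp_ofReal_mul_I_re]

lemma differentiableAt_log_Gamma {x : ℝ} (hx : 0 < x) :
    DifferentiableAt ℝ (Real.log ∘ Real.Gamma) x :=
  (Real.differentiableAt_Gamma fun m ↦ by linarith [m.cast_nonneg (α := ℝ)]).log
    (Real.Gamma_pos_of_pos hx).ne'

lemma digamma_eq_deriv_log_Gamma {x : ℝ} (hx : 0 < x) :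
    digamma x = deriv (Real.log ∘ Real.Gamma) x := by
  rw [Function.comp_def, deriv.log
    (Real.differentiableAt_Gamma fun m ↦ by linarith [m.cast_nonneg (α := ℝ)])
    (Real.Gamma_pos_of_pos hx).ne', digamma]

lemma log_Gamma_add_one {x : ℝ} (hx : 0 < x) :
    (Real.log ∘ Real.Gamma) (x + 1) = (Real.log ∘ Real.Gamma) x + Real.log x := by
  simp only [Function.comp_apply, Real.Gamma_add_one hx.ne',
    Real.log_mul hx.ne' (Real.Gamma_pos_of_pos hx).ne', add_comm]

lemma digamma_add_one {x : ℝ} (hx : 0 < x) : digamma (x + 1) = digamma x + 1 / x := by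
  rw [digamma_eq_deriv_log_Gamma hx, digamma_eq_deriv_log_Gamma (by positivity),
    ← deriv_comp_add_const, one_div, ← Real.deriv_log,
    ← deriv_add (differentiableAt_log_Gamma hx) (Real.differentiableAt_log hx.ne')]
  apply EventuallyEq.deriv_eq
  filter_upwards [eventually_gt_nhds hx] with y hy using log_Gamma_add_one hy

lemma digamma_add_natCast {x : ℝ} (hx : 0 < x) (N : ℕ) :
    digamma (x + N) = digamma x + ∑ k ∈ range N, 1 / (x + k) := by
  induction N with
  | zero => simp
  | succ N ih =>
    rw [Nat.cast_succ, ← add_assoc, digamma_add_one (by positivity), ih, sum_range_succ, add_assoc]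

lemma digamma_le_log {x : ℝ} (hx : 0 < x) : digamma x ≤ Real.log x := by
  rw [digamma_eq_deriv_log_Gamma hx]
  refine (Real.convexOn_log_Gamma.deriv_le_slope (Set.mem_Ioi.mpr hx)
    (Set.mem_Ioi.mpr (by positivity : 0 < x + 1)) (by linarith)
    (differentiableAt_log_Gamma hx)).trans_eq ?_
  rw [slope_def_field, log_Gamma_add_one hx]
  ring

lemma log_sub_one_div_le_digamma {x : ℝ} (hx : 0 < x) : Real.log x - 1 / x ≤ digamma x := by
  rw [sub_le_iff_le_add, ← digamma_add_one hx, digamma_eq_deriv_log_Gamma (by positivity)]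
  refine le_of_eq_of_le ?_ (Real.convexOn_log_Gamma.slope_le_deriv (Set.mem_Ioi.mpr hx)
    (Set.mem_Ioi.mpr (by positivity : 0 < x + 1)) (by linarith)
    (differentiableAt_log_Gamma (by positivity)))
  rw [slope_def_field, log_Gamma_add_one hx]
  ring

lemma tendsto_sum_one_div_add_sub_log {x : ℝ} (hx : 0 < x) :
    Tendsto (fun N : ℕ ↦ ∑ k ∈ range N, 1 / (x + k) - Real.log N) atTop (𝓝 (-digamma x)) := by
  have hadd : Tendsto (fun N : ℕ ↦ x + (N : ℝ)) atTop atTop :=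
    tendsto_atTop_add_const_left _ _ tendsto_natCast_atTop_atTop
  have h1 : Tendsto (fun N : ℕ ↦ digamma (x + N) - Real.log (x + N)) atTop (𝓝 0) := by
    have hinv : Tendsto (fun N : ℕ ↦ -(1 / (x + (N : ℝ)))) atTop (𝓝 0) := by
      simpa using (tendsto_inv_atTop_zero.comp hadd).neg
    refine tendsto_of_tendsto_of_tendsto_of_le_of_le hinv tendsto_const_nhds
      (fun N ↦ ?_) fun N ↦ ?_
    · have := log_sub_one_div_le_digamma (show 0 < x + (N : ℝ) by positivity)
      dsimp only
      linarith
    · have := digamma_le_log (show 0 < x + (N : ℝ) by positivity)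
      dsimp only
      linarith
  have h2 : Tendsto (fun N : ℕ ↦ Real.log (x + N) - Real.log N) atTop (𝓝 0) := by
    simpa [Function.comp_def, add_comm] using
      (Real.tendsto_log_comp_add_sub_log x).comp tendsto_natCast_atTop_atTop
  have h := (h1.add h2).sub_const (digamma x)
  rw [add_zero, zero_sub] at h
  refine h.congr fun N ↦ ?_
  rw [digamma_add_natCast hx]
  ring

lemma tendsto_sum_one_div_natCast_sub_log :
    Tendsto (fun N : ℕ ↦ ∑ m ∈ range N, 1 / (m : ℝ) - Real.log N) atTop
      (𝓝 Real.eulerMascheroniConstant) := by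
  rw [← tendsto_add_atTop_iff_nat 1]
  refine Real.tendsto_harmonic_sub_log_add_one.congr fun N ↦ ?_
  rw [sum_range_succ']
  simp [harmonic]

lemma sum_range_cos_two_pi_mul_div {n : ℕ} (hn : n ≠ 0) (a : ℤ) :
    ∑ ν ∈ range n, Real.cos (2 * π * ν * a / n) = if (n : ℤ) ∣ a then (n : ℝ) else 0 := by
  have hn' : (n : ℝ) ≠ 0 := Nat.cast_ne_zero.mpr hn
  split_ifs with h
  · obtain ⟨b, rfl⟩ := h
    have hone (ν : ℕ) : Real.cos (2 * π * ν * ((n * b : ℤ) : ℝ) / n) = 1 := by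
      rw [Real.cos_eq_one_iff]
      exact ⟨ν * b, by push_cast; field_simp⟩
    simp_rw [hone]
    simp
  · have hne (k : ℤ) : 2 * π * a / n ≠ k * (2 * π) := fun hk ↦ h ⟨k, by
      rw [div_eq_iff hn'] at hk
      have : (a : ℝ) = n * k := mul_left_cancel₀ Real.two_pi_pos.ne' (by linarith)
      exact_mod_cast this⟩
    have hsum := Real.sum_cos n hne 0
    have hsin : Real.sin (n * (2 * π * a / n) / 2) = 0 := by
      rw [show n * (2 * π * a / n) / 2 = a * π by field_simp]
      exact Real.sin_int_mul_pi a
    have hcongr : ∑ ν ∈ range n, Real.cos (2 * π * ν * a / n) =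
        ∑ i ∈ range n, Real.cos (2 * π * a / n * i + 0) :=
      sum_congr rfl fun ν _ ↦ by congr 1; ring
    rw [hcongr, hsum]
    simp [hsin]

lemma sum_Icc_cos_two_pi_mul_div {n : ℕ} (hn : n ≠ 0) (a : ℤ) :
    ∑ ν ∈ Icc 1 (n - 1), Real.cos (2 * π * ν * a / n) =
      (if (n : ℤ) ∣ a then (n : ℝ) else 0) - 1 := by
  have hIcc : Icc 1 (n - 1) = Ico (0 + 1) n := by ext; simp; lia
  rw [← sum_range_cos_two_pi_mul_div hn, range_eq_Ico, hIcc,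
    sum_eq_sum_Ico_succ_bot (Nat.pos_of_ne_zero hn)]
  simp

lemma sum_range_mul_ite_dvd_sub {n r : ℕ} (hr : r < n) (g : ℕ → ℝ) (N : ℕ) :
    ∑ m ∈ range (n * N), (if (n : ℤ) ∣ m - r then g m else 0) =
      ∑ k ∈ range N, g (n * k + r) := by
  induction N with
  | zero => simp
  | succ N ih =>
    rw [mul_add, mul_one, sum_range_add, ih, sum_range_succ, add_right_inj,
      sum_eq_single r]
    · simp
    · intro j hj hjr
      rw [if_neg]
      rintro ⟨c, hc⟩
      rw [mem_range] at hj
      push_cast at hc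
      have hc' : (j : ℤ) - r = n * (c - N) := by linarith
      have : (j : ℤ) - r = 0 :=
        Int.eq_zero_of_abs_lt_dvd ⟨_, hc'⟩ (abs_lt.mpr ⟨by lia, by lia⟩)
      lia
    · intro h
      exact absurd (mem_range.mpr hr) h

/-- The even part of Gauss's digamma theorem. -/
lemma sum_cos_mul_log_two_mul_sin {n r : ℕ} (hr0 : 0 < r) (hrn : r < n) :
    ∑ ν ∈ Icc 1 (n - 1), Real.cos (2 * π * ν * r / n) * Real.log (2 * Real.sin (π * ν / n)) =
      Real.eulerMascheroniConstant + Real.log n +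
        (digamma (r / n) + digamma ((n - r : ℕ) / n)) / 2 := by
  have hn : 0 < n := hr0.trans hrn
  have hn' : (0 : ℝ) < n := Nat.cast_pos.mpr hn
  have hmul : Tendsto (fun N : ℕ ↦ n * N) atTop atTop := tendsto_id.const_mul_atTop' hn
  have hleft : Tendsto (fun N : ℕ ↦ ∑ ν ∈ Icc 1 (n - 1), Real.cos (2 * π * ν * r / n) *
      ∑ m ∈ range (n * N), Real.cos (2 * m * (π * ν / n)) / m) atTop
      (𝓝 (∑ ν ∈ Icc 1 (n - 1), Real.cos (2 * π * ν * r / n) *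
        -Real.log (2 * Real.sin (π * ν / n)))) := by
    refine tendsto_finsetSum _ fun ν hν ↦ Tendsto.const_mul _ ?_
    rw [mem_Icc] at hν
    have hν0 : (0 : ℝ) < ν := Nat.cast_pos.mpr hν.1
    have hνn : (ν : ℝ) < n := Nat.cast_lt.mpr (by lia)
    refine (Real.tendsto_sum_cos_div (by positivity) ?_).comp hmul
    rw [div_lt_iff₀ hn']
    exact mul_lt_mul_of_pos_left hνn Real.pi_pos
  have hsum (N : ℕ) : ∑ ν ∈ Icc 1 (n - 1), Real.cos (2 * π * ν * r / n) *
      ∑ m ∈ range (n * N), Real.cos (2 * m * (π * ν / n)) / m =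
      (∑ k ∈ range N, 1 / ((r : ℝ) / n + k) + ∑ k ∈ range N, 1 / (((n - r : ℕ) : ℝ) / n + k)) / 2
        - ∑ m ∈ range (n * N), 1 / (m : ℝ) := by
    have hterm (m : ℕ) : ∑ ν ∈ Icc 1 (n - 1),
        Real.cos (2 * π * ν * r / n) * (Real.cos (2 * m * (π * ν / n)) / m) =
        ((if (n : ℤ) ∣ m - r then (n : ℝ) / m else 0) +
          (if (n : ℤ) ∣ m - (n - r : ℕ) then (n : ℝ) / m else 0)) / 2 - 1 / m := by
      have hprod (ν : ℕ) :
          Real.cos (2 * π * ν * r / n) * (Real.cos (2 * m * (π * ν / n)) / m) =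
          (Real.cos (2 * π * ν * (m - r : ℤ) / n) + Real.cos (2 * π * ν * (m + r : ℤ) / n)) *
            (1 / (2 * m)) := by
        have h1 : 2 * π * ν * ((m - r : ℤ) : ℝ) / n =
            2 * m * (π * ν / n) - 2 * π * ν * r / n := by push_cast; ring
        have h2 : 2 * π * ν * ((m + r : ℤ) : ℝ) / n =
            2 * m * (π * ν / n) + 2 * π * ν * r / n := by push_cast; ring
        rw [h1, h2, Real.cos_sub, Real.cos_add]
        ring
      have hdvd : (n : ℤ) ∣ m + r ↔ (n : ℤ) ∣ m - (n - r : ℕ) := by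
        rw [Nat.cast_sub hrn.le, show (m : ℤ) - (n - r) = m + r - n by ring,
          dvd_sub_self_right]
      simp_rw [hprod]
      rw [← sum_mul, sum_add_distrib, sum_Icc_cos_two_pi_mul_div hn.ne',
        sum_Icc_cos_two_pi_mul_div hn.ne', if_congr hdvd rfl rfl]
      split_ifs <;> ring
    have hdiv (s k : ℕ) : (n : ℝ) / ((n * k + s : ℕ) : ℝ) = 1 / ((s : ℝ) / n + k) := by
      rw [show (s : ℝ) / n + k = ((n * k + s : ℕ) : ℝ) / n by push_cast; field_simp; ring,
        one_div_div]
    simp_rw [mul_sum]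
    rw [sum_comm]
    simp_rw [hterm]
    rw [sum_sub_distrib, ← sum_div, sum_add_distrib,
      sum_range_mul_ite_dvd_sub hrn fun m ↦ (n : ℝ) / m,
      sum_range_mul_ite_dvd_sub (Nat.sub_lt hn hr0) fun m ↦ (n : ℝ) / m]
    simp_rw [hdiv]
  have hright := (((tendsto_sum_one_div_add_sub_log
      (show (0 : ℝ) < r / n by positivity)).add (tendsto_sum_one_div_add_sub_log
      (show (0 : ℝ) < (n - r : ℕ) / n from
        div_pos (Nat.cast_pos.mpr (Nat.sub_pos_of_lt hrn)) hn'))).div_const 2).sub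
      (tendsto_sum_one_div_natCast_sub_log.comp hmul) |>.sub_const (Real.log n)
  have hlim := tendsto_nhds_unique (hleft.congr hsum) (hright.congr' (by
    filter_upwards [eventually_gt_atTop 0] with N hN
    have hN' : (N : ℝ) ≠ 0 := Nat.cast_ne_zero.mpr hN.ne'
    simp only [Function.comp_apply]
    rw [Nat.cast_mul, Real.log_mul hn'.ne' hN']
    ring))
  simp only [mul_neg, sum_neg_distrib] at hlim
  linarith

lemma sum_cos_mul_log_sin {n r : ℕ} (hr0 : 0 < r) (hrn : r < n) :
    ∑ ν ∈ Icc 1 (n - 1), Real.cos (2 * π * ν * r / n) * Real.log (Real.sin (π * ν / n)) =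
      Real.eulerMascheroniConstant + Real.log (2 * n) +
        (digamma (r / n) + digamma ((n - r : ℕ) / n)) / 2 := by
  have hn : 0 < n := hr0.trans hrn
  have hn' : (0 : ℝ) < n := Nat.cast_pos.mpr hn
  have hsplit : ∑ ν ∈ Icc 1 (n - 1),
      Real.cos (2 * π * ν * r / n) * Real.log (2 * Real.sin (π * ν / n)) =
      ∑ ν ∈ Icc 1 (n - 1), (Real.cos (2 * π * ν * (r : ℤ) / n) * Real.log 2 +
        Real.cos (2 * π * ν * r / n) * Real.log (Real.sin (π * ν / n))) := by
    refine sum_congr rfl fun ν hν ↦ ?_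
    rw [mem_Icc] at hν
    have hν0 : (0 : ℝ) < ν := Nat.cast_pos.mpr hν.1
    have hνn : (ν : ℝ) < n := Nat.cast_lt.mpr (by lia)
    have hsin : 0 < Real.sin (π * ν / n) := by
      refine Real.sin_pos_of_pos_of_lt_pi (by positivity) ?_
      rw [div_lt_iff₀ hn']
      exact mul_lt_mul_of_pos_left hνn Real.pi_pos
    rw [Real.log_mul two_ne_zero hsin.ne', Int.cast_natCast]
    ring
  have hndvd : ¬ (n : ℤ) ∣ r := fun h ↦
    absurd (Nat.le_of_dvd hr0 (Int.natCast_dvd_natCast.mp h)) (by lia)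
  have h := sum_cos_mul_log_two_mul_sin hr0 hrn
  rw [hsplit, sum_add_distrib, ← sum_mul, sum_Icc_cos_two_pi_mul_div hn.ne', if_neg hndvd] at h
  rw [Real.log_mul two_ne_zero hn'.ne']
  linarith

theorem sum_C_log_sin (n : ℕ) (hn : 2 ≤ n) :
    ∑ ν ∈ Finset.Icc 1 (n - 1), C n (ν : ℤ) * Real.log (Real.sin (π * ν / n))
      = (Real.eulerMascheroniConstant + Real.log (2 * n)) * S n
        + ∑ r ∈ Finset.Icc 1 (n - 1), digamma ((r : ℝ) / n) * (1 / Real.sin (π * r / n)) := by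
  have hn' : (n : ℝ) ≠ 0 := by positivity
  have hreflect : ∑ r ∈ Icc 1 (n - 1), digamma ((n - r : ℕ) / n) * (1 / Real.sin (π * r / n)) =
      ∑ r ∈ Icc 1 (n - 1), digamma ((r : ℝ) / n) * (1 / Real.sin (π * r / n)) := by
    refine sum_nbij' (fun r ↦ n - r) (fun r ↦ n - r) ?_ ?_ ?_ ?_ ?_
    · intro r hr; rw [mem_Icc] at hr ⊢; lia
    · intro r hr; rw [mem_Icc] at hr ⊢; lia
    · intro r hr; rw [mem_Icc] at hr; lia
    · intro r hr; rw [mem_Icc] at hr; lia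
    · intro r hr
      rw [mem_Icc] at hr
      rw [Nat.cast_sub (by lia : r ≤ n),
        show π * ((n : ℝ) - r) / n = π - π * r / n by field_simp, Real.sin_pi_sub]
  have hswap : ∑ ν ∈ Icc 1 (n - 1), C n (ν : ℤ) * Real.log (Real.sin (π * ν / n)) =
      ∑ l ∈ Icc 1 (n - 1), (Real.eulerMascheroniConstant + Real.log (2 * n) +
        (digamma (l / n) + digamma ((n - l : ℕ) / n)) / 2) * (1 / Real.sin (π * l / n)) := by
    simp_rw [C, sum_mul]
    rw [sum_comm]
    refine sum_congr rfl fun l hl ↦ ?_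
    rw [mem_Icc] at hl
    rw [← sum_cos_mul_log_sin (by lia : 0 < l) (by lia : l < n), sum_mul]
    refine sum_congr rfl fun ν _ ↦ ?_
    rw [Int.cast_natCast]
    ring
  have hexpand (l : ℕ) : (Real.eulerMascheroniConstant + Real.log (2 * n) +
        (digamma (l / n) + digamma ((n - l : ℕ) / n)) / 2) * (1 / Real.sin (π * l / n)) =
      (Real.eulerMascheroniConstant + Real.log (2 * n)) * (1 / Real.sin (π * l / n)) +
        (digamma (l / n) * (1 / Real.sin (π * l / n)) +
          digamma ((n - l : ℕ) / n) * (1 / Real.sin (π * l / n))) / 2 := by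
    ring
  rw [hswap, S]
  simp_rw [hexpand]
  rw [sum_add_distrib, ← mul_sum, ← sum_div, sum_add_distrib, hreflect, add_self_div_two]
end

section
/- For every integer n ≥ 2, Σ_{ν=1}^{n−1} C_n(ν)·Ψ(ν/n) = (γ + n·ln 2)·S_n − n·Σ_{ν=1}^{n−1} csc(πν/n)·ln(csc(πν/n)). -/
open Real Finset

open Filter Topology

lemma differentiableAt_Gamma_of_pos {x : ℝ} (hx : 0 < x) : DifferentiableAt ℝ Gamma x :=
  differentiableAt_Gamma fun m ↦ ((neg_nonpos.mpr m.cast_nonneg).trans_lt hx).ne'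

lemma digamma_one : digamma 1 = -eulerMascheroniConstant := by
  rw [digamma, hasDerivAt_Gamma_one.deriv, Gamma_one, div_one]

lemma monotoneOn_digamma : MonotoneOn digamma (Set.Ioi 0) := by
  have hd : ∀ x ∈ Set.Ioi (0 : ℝ), DifferentiableAt ℝ (log ∘ Gamma) x := fun x hx ↦
    (differentiableAt_Gamma_of_pos hx).log (Gamma_pos_of_pos hx).ne'
  refine (convexOn_log_Gamma.monotoneOn_deriv hd).congr fun x hx ↦ ?_
  exact deriv.log (differentiableAt_Gamma_of_pos hx) (Gamma_pos_of_pos hx).ne'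

lemma tendsto_digamma_sub_sum {x : ℝ} (hx : 0 < x) (hx1 : x ≤ 1) :
    Tendsto (fun N : ℕ ↦ digamma N - ∑ k ∈ range N, 1 / (x + k)) atTop (𝓝 (digamma x)) := by
  have h : Tendsto (fun N : ℕ ↦ digamma (x + N) - digamma N) atTop (𝓝 0) := by
    refine tendsto_of_tendsto_of_tendsto_of_le_of_le' tendsto_const_nhds
      tendsto_one_div_atTop_nhds_zero_nat ?_ ?_ <;>
      filter_upwards [eventually_gt_atTop 0] with N hN
    all_goals have hN' : (0 : ℝ) < N := by exact_mod_cast hN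
    · exact sub_nonneg.2 (monotoneOn_digamma hN' (Set.mem_Ioi.2 (by positivity)) (by linarith))
    · rw [sub_le_iff_le_add', ← digamma_add_one hN']
      exact monotoneOn_digamma (Set.mem_Ioi.2 (by positivity)) (Set.mem_Ioi.2 (by positivity))
        (by linarith)
  simpa [digamma_add_natCast hx, sub_sub_eq_add_sub, add_sub_assoc] using
    (tendsto_const_nhds (x := digamma x)).sub h

/-- The Taylor series of `-log (1 - w)` converges on the unit circle away from `1`. -/
lemma tendsto_sum_pow_div_neg_log {w : ℂ} (hw : ‖w‖ = 1) (hw1 : w ≠ 1) :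
    Tendsto (fun N : ℕ ↦ ∑ i ∈ range N, w ^ (i + 1) / ((i + 1 : ℕ) : ℂ)) atTop
      (𝓝 (-Complex.log (1 - w))) := by
  have hshift (N : ℕ) : ∑ i ∈ range (N + 1), w ^ i / (i : ℂ)
      = ∑ i ∈ range N, w ^ (i + 1) / ((i + 1 : ℕ) : ℂ) := by
    rw [sum_range_succ']; simp
  have hbound (N : ℕ) : ‖∑ i ∈ range N, w ^ (i + 1)‖ ≤ 2 / ‖w - 1‖ := by
    simp_rw [pow_succ]
    rw [← sum_mul, geom_sum_eq hw1, norm_mul, hw, mul_one, norm_div]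
    gcongr
    refine (norm_sub_le _ _).trans ?_
    simp [hw]
    norm_num
  have hanti : Antitone fun i : ℕ ↦ 1 / ((i : ℝ) + 1) := fun a b hab ↦ by
    dsimp only; gcongr
  obtain ⟨l, hl⟩ := cauchySeq_tendsto_of_complete
    (hanti.cauchySeq_series_mul_of_tendsto_zero_of_bounded
      tendsto_one_div_add_atTop_nhds_zero_nat hbound)
  have hl' : Tendsto (fun N : ℕ ↦ ∑ i ∈ range N, w ^ (i + 1) / ((i + 1 : ℕ) : ℂ)) atTop (𝓝 l) := by
    refine hl.congr fun N ↦ sum_congr rfl fun i _ ↦ ?_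
    rw [Complex.real_smul]
    push_cast
    ring
  have habel := Complex.tendsto_tsum_powerSeries_nhdsWithin_lt (f := fun i ↦ w ^ i / (i : ℂ))
    ((tendsto_add_atTop_iff_nat 1).1 (hl'.congr fun N ↦ (hshift N).symm))
  rw [tendsto_map'_iff] at habel
  have hre : w.re < 1 := by
    refine lt_of_le_of_ne (hw ▸ Complex.re_le_norm w) fun h ↦ hw1 ?_
    have h2 := Complex.sq_norm w
    rw [Complex.normSq_apply, hw, h] at h2
    exact Complex.ext h (by simpa using h2)
  have hcont : Tendsto (fun r : ℝ ↦ -Complex.log (1 - w * r)) (𝓝[<] 1)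
      (𝓝 (-Complex.log (1 - w))) := by
    have hc : ContinuousAt (fun r : ℝ ↦ -Complex.log (1 - w * r)) 1 := by
      refine (ContinuousAt.clog (by fun_prop) (Or.inl ?_)).neg
      simpa using hre
    simpa using hc.tendsto.mono_left nhdsWithin_le_nhds
  have heq : (fun r : ℝ ↦ -Complex.log (1 - w * r)) =ᶠ[𝓝[<] 1]
      ((fun z : ℂ ↦ ∑' i : ℕ, w ^ i / (i : ℂ) * z ^ i) ∘ Complex.ofReal) := by
    filter_upwards [Ioo_mem_nhdsLT (show (0 : ℝ) < 1 by norm_num)] with r hr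
    have hn : ‖w * r‖ < 1 := by
      rw [norm_mul, hw, one_mul, Complex.norm_real, norm_of_nonneg hr.1.le]; exact hr.2
    rw [← (Complex.hasSum_taylorSeries_neg_log hn).tsum_eq]
    refine tsum_congr fun i ↦ ?_
    rw [mul_pow]; ring
  rwa [tendsto_nhds_unique (hcont.congr' heq) habel]

lemma sum_range_mul_eq_sum_sum {M : Type*} [AddCommMonoid M] (f : ℕ → M) (n N : ℕ) :
    ∑ i ∈ range (n * N), f i = ∑ k ∈ range N, ∑ j ∈ range n, f (n * k + j) := by
  induction N with
  | zero => simp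
  | succ N ih => rw [sum_range_succ, ← ih, mul_add_one, sum_range_add]

/-- Gauss's evaluation of the discrete Fourier transform of the digamma function. -/
lemma sum_pow_mul_digamma {n : ℕ} (hn : 0 < n) {w : ℂ} (hwn : w ^ n = 1) (hw1 : w ≠ 1) :
    ∑ j ∈ range n, w ^ (j + 1) * (digamma (((j + 1 : ℕ) : ℝ) / n) : ℂ)
      = n * Complex.log (1 - w) := by
  have hn' : (0 : ℝ) < n := by exact_mod_cast hn
  have hnC : (n : ℂ) ≠ 0 := by exact_mod_cast hn.ne'
  have hw : ‖w‖ = 1 := Complex.norm_eq_one_of_pow_eq_one hwn hn.ne'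
  have hgeom : ∑ j ∈ range n, w ^ (j + 1) = 0 := by
    simp_rw [pow_succ]
    rw [← sum_mul, geom_sum_eq hw1, hwn, sub_self, zero_div, zero_mul]
  have h1 : Tendsto (fun N : ℕ ↦ ∑ j ∈ range n, w ^ (j + 1) *
      ((digamma N - ∑ k ∈ range N, 1 / (((j + 1 : ℕ) : ℝ) / n + k) : ℝ) : ℂ)) atTop
      (𝓝 (∑ j ∈ range n, w ^ (j + 1) * (digamma (((j + 1 : ℕ) : ℝ) / n) : ℂ))) := by
    refine tendsto_finsetSum _ fun j hj ↦ Tendsto.const_mul _ ?_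
    refine (Complex.continuous_ofReal.tendsto _).comp (tendsto_digamma_sub_sum (by positivity) ?_)
    rw [div_le_one hn']
    exact_mod_cast mem_range.1 hj
  have h2 := ((tendsto_sum_pow_div_neg_log hw hw1).comp
    (tendsto_id.const_mul_atTop' hn)).const_mul (-(n : ℂ))
  rw [neg_mul_neg] at h2
  refine tendsto_nhds_unique h1 (h2.congr fun N ↦ ?_)
  simp only [Function.comp_apply, id]
  rw [sum_range_mul_eq_sum_sum, sum_comm]
  simp_rw [Complex.ofReal_sub, mul_sub]
  rw [sum_sub_distrib, ← sum_mul, hgeom, zero_mul, zero_sub, mul_sum, ← sum_neg_distrib]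
  refine sum_congr rfl fun j _ ↦ ?_
  rw [Complex.ofReal_sum, mul_sum, mul_sum, ← sum_neg_distrib]
  refine sum_congr rfl fun k _ ↦ ?_
  have h3 : ((n * k + j + 1 : ℕ) : ℂ) ≠ 0 := Nat.cast_ne_zero.2 (Nat.succ_ne_zero _)
  have h4 : ((j + 1 : ℕ) : ℂ) / n + k = ((n * k + j + 1 : ℕ) : ℂ) / n := by
    push_cast; field_simp; ring
  rw [add_assoc (n * k), pow_add, pow_mul, hwn, one_pow, one_mul, ← add_assoc]
  push_cast at h3 h4 ⊢
  rw [h4]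
  field_simp

lemma norm_one_sub_exp_mul_I {x : ℝ} (hx : 0 ≤ sin (x / 2)) :
    ‖1 - Complex.exp (x * Complex.I)‖ = 2 * sin (x / 2) := by
  have h : 1 - Complex.exp (x * Complex.I)
      = ((2 * sin (x / 2) : ℝ) : ℂ) * (-Complex.I * Complex.exp ((x / 2 : ℝ) * Complex.I)) := by
    have h1 : Complex.exp (x * Complex.I) = Complex.exp ((x / 2 : ℝ) * Complex.I) ^ 2 := by
      rw [← Complex.exp_nat_mul]; push_cast; ring_nf
    have h2 : (cos (x / 2) : ℂ) ^ 2 = 1 - (sin (x / 2) : ℂ) ^ 2 := by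
      exact_mod_cast cos_sq' (x / 2)
    rw [h1, Complex.exp_mul_I, ← Complex.ofReal_cos, ← Complex.ofReal_sin]
    push_cast at h2 ⊢
    linear_combination (-1 : ℂ) * h2 + Complex.sin (x / 2) ^ 2 * Complex.I_sq
  rw [h, norm_mul, Complex.norm_real, norm_mul (-Complex.I), Complex.norm_exp_ofReal_mul_I]
  simp [abs_of_nonneg hx]

/-- Gauss's digamma theorem, in its Fourier-transformed form. -/
lemma sum_cos_mul_digamma {n l : ℕ} (hl : 0 < l) (hln : l < n) :
    ∑ ν ∈ Icc 1 (n - 1), cos (2 * π * ν * l / n) * digamma ((ν : ℝ) / n)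
      = n * log (2 * sin (π * l / n)) + eulerMascheroniConstant := by
  have hn : 0 < n := hl.trans hln
  have hn' : (0 : ℝ) < n := by exact_mod_cast hn
  have hl' : (0 : ℝ) < l := by exact_mod_cast hl
  have hsin : 0 < sin (π * l / n) := by
    refine sin_pos_of_pos_of_lt_pi (by positivity) ?_
    rw [div_lt_iff₀ hn']
    exact mul_lt_mul_of_pos_left (by exact_mod_cast hln) pi_pos
  set θ : ℝ := 2 * π * l / n with hθ
  set w : ℂ := Complex.exp (θ * Complex.I) with hw
  have hhalf : θ / 2 = π * l / n := by rw [hθ]; ring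
  have hnorm : ‖1 - w‖ = 2 * sin (π * l / n) := by
    rw [hw, norm_one_sub_exp_mul_I (by rw [hhalf]; exact hsin.le), hhalf]
  have hw1 : w ≠ 1 := by
    intro h
    rw [h, sub_self, norm_zero] at hnorm
    linarith
  have hpow (m : ℕ) : w ^ m = Complex.exp ((m * θ : ℝ) * Complex.I) := by
    rw [hw, ← Complex.exp_nat_mul]; push_cast; ring_nf
  have hwn : w ^ n = 1 := by
    rw [hpow, Complex.exp_eq_one_iff]
    refine ⟨l, ?_⟩
    rw [hθ, mul_div_cancel₀ _ hn'.ne']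
    push_cast; ring
  have key := congrArg Complex.re (sum_pow_mul_digamma hn hwn hw1)
  rw [Complex.re_sum, ← Complex.ofReal_natCast n, Complex.re_ofReal_mul, Complex.log_re, hnorm]
    at key
  have hterm (j : ℕ) : (w ^ (j + 1) * (digamma (((j + 1 : ℕ) : ℝ) / n) : ℂ)).re
      = cos (2 * π * (j + 1 : ℕ) * l / n) * digamma (((j + 1 : ℕ) : ℝ) / n) := by
    rw [Complex.re_mul_ofReal, hpow, Complex.exp_ofReal_mul_I_re, hθ]
    ring_nf
  simp_rw [hterm] at key
  obtain ⟨m, rfl⟩ : ∃ m, n = m + 1 := ⟨n - 1, by omega⟩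
  have hlast : cos (2 * π * (m + 1 : ℕ) * l / (m + 1 : ℕ)) = 1 := by
    rw [show 2 * π * (m + 1 : ℕ) * l / (m + 1 : ℕ) = l * (2 * π) by field_simp,
      cos_nat_mul_two_pi]
  rw [sum_range_succ, hlast, div_self hn'.ne', digamma_one] at key
  rw [Nat.add_sub_cancel, ← key, ← Ico_add_one_right_eq_Icc, sum_Ico_eq_sum_range]
  simp [add_comm]

theorem sum_C_digamma (n : ℕ) (hn : 2 ≤ n) :
    ∑ ν ∈ Finset.Icc 1 (n - 1), C n (ν : ℤ) * digamma ((ν : ℝ) / n)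
      = (Real.eulerMascheroniConstant + (n : ℝ) * Real.log 2) * S n
        - (n : ℝ) * ∑ ν ∈ Finset.Icc 1 (n - 1),
            (1 / Real.sin (π * ν / n)) * Real.log (1 / Real.sin (π * ν / n)) := by
  have hswap : ∑ ν ∈ Icc 1 (n - 1), C n (ν : ℤ) * digamma ((ν : ℝ) / n)
      = ∑ l ∈ Icc 1 (n - 1), 1 / sin (π * l / n) *
          ∑ ν ∈ Icc 1 (n - 1), cos (2 * π * ν * l / n) * digamma ((ν : ℝ) / n) := by
    simp_rw [C, sum_mul, mul_sum]
    rw [sum_comm]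
    refine sum_congr rfl fun l _ ↦ sum_congr rfl fun ν _ ↦ ?_
    push_cast
    ring
  rw [hswap, S, mul_sum, mul_sum, ← sum_sub_distrib]
  refine sum_congr rfl fun l hl ↦ ?_
  rw [mem_Icc] at hl
  have hn' : (0 : ℝ) < n := by exact_mod_cast (by omega : 0 < n)
  have hl' : (0 : ℝ) < l := by exact_mod_cast (by omega : 0 < l)
  have hsin : 0 < sin (π * l / n) := by
    refine sin_pos_of_pos_of_lt_pi (by positivity) ?_
    rw [div_lt_iff₀ hn']
    exact mul_lt_mul_of_pos_left (by exact_mod_cast (by omega : l < n)) pi_pos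
  rw [sum_cos_mul_digamma (by omega) (by omega), log_mul two_ne_zero hsin.ne', one_div, log_inv]
  ring
end

section
/- For every integer n ≥ 2 and every integer ν with 1 ≤ ν ≤ n − 1, C_n(ν) = (2n/π) · ∫₀¹ [ (1 + xⁿ)·cos(2πν/n) − x^{n−1} − x ] / [ (1 + xⁿ)·(x² − 2x·cos(2πν/n) + 1) ] dx. -/
open Real Finset

open MeasureTheory intervalIntegral

/-- Multiplying the truncated generating function of `cos ((l + 1) θ)` by its denominator. -/
lemma sum_cos_mul_pow_mul_quadratic (θ x : ℝ) (m : ℕ) :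
    (∑ l ∈ Finset.range m, Real.cos ((l + 1) * θ) * x ^ l) * (x ^ 2 - 2 * x * Real.cos θ + 1)
      = Real.cos θ - x - Real.cos ((m + 1) * θ) * x ^ m + Real.cos (m * θ) * x ^ (m + 1) := by
  induction m with
  | zero => simp
  | succ k ih =>
    have h : Real.cos ((k + 1 + 1) * θ) = 2 * Real.cos θ * Real.cos ((k + 1) * θ)
        - Real.cos (k * θ) := by
      rw [show (k + 1 + 1 : ℝ) * θ = (k + 1) * θ + θ by ring,
        show (k : ℝ) * θ = (k + 1) * θ - θ by ring, Real.cos_add, Real.cos_sub]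
      ring
    rw [Finset.sum_range_succ, add_mul, ih]
    push_cast
    rw [h]
    ring

lemma ofReal_beta_integrand {s u : ℝ} (hu : u ∈ Set.Icc (0 : ℝ) 1) :
    (u : ℂ) ^ ((s : ℂ) - 1) * (1 - (u : ℂ)) ^ (((1 - s : ℝ) : ℂ) - 1)
      = ((u ^ (s - 1) * (1 - u) ^ (-s) : ℝ) : ℂ) := by
  rw [Complex.ofReal_mul, Complex.ofReal_cpow hu.1, Complex.ofReal_cpow (sub_nonneg.2 hu.2)]
  push_cast
  ring_nf

lemma intervalIntegrable_beta_one_sub {s : ℝ} (h0 : 0 < s) (h1 : s < 1) :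
    IntervalIntegrable (fun u : ℝ => u ^ (s - 1) * (1 - u) ^ (-s)) volume 0 1 := by
  have h := Complex.betaIntegral_convergent (u := (s : ℂ)) (v := ((1 - s : ℝ) : ℂ))
    (by simpa using h0) (by simpa using h1)
  rw [intervalIntegrable_iff_integrableOn_Ioc_of_le zero_le_one] at h ⊢
  refine IntegrableOn.congr_fun h.re (fun u hu => ?_) measurableSet_Ioc
  simp only [ofReal_beta_integrand ⟨hu.1.le, hu.2⟩]
  simp

/-- The reflection formula as a beta integral. -/
lemma integral_beta_one_sub {s : ℝ} (h0 : 0 < s) (h1 : s < 1) :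
    ∫ u in (0 : ℝ)..1, u ^ (s - 1) * (1 - u) ^ (-s) = π / Real.sin (π * s) := by
  have h := Complex.Gamma_mul_Gamma_eq_betaIntegral (s := (s : ℂ)) (t := ((1 - s : ℝ) : ℂ))
    (by simpa using h0) (by simpa using h1)
  rw [Complex.betaIntegral, integral_congr (g := fun u : ℝ =>
    ((u ^ (s - 1) * (1 - u) ^ (-s) : ℝ) : ℂ)) fun u hu => ofReal_beta_integrand
      (by rwa [Set.uIcc_of_le zero_le_one] at hu), intervalIntegral.integral_ofReal,
    ← Complex.ofReal_add, add_sub_cancel, Complex.ofReal_one, Complex.Gamma_one, one_mul,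
    Complex.Gamma_ofReal, Complex.Gamma_ofReal] at h
  rw [← Real.Gamma_mul_Gamma_one_sub]
  exact_mod_cast h.symm

/-- The odds map `x ↦ xⁿ / (1 + xⁿ)` sends the unit interval onto `(0, 1/2)`. -/
lemma image_pow_div_one_add_pow {n : ℕ} (hn : n ≠ 0) :
    (fun x : ℝ => x ^ n / (1 + x ^ n)) '' Set.Ioo 0 1 = Set.Ioo 0 (1 / 2) := by
  ext u
  constructor
  · rintro ⟨x, ⟨hx0, hx1⟩, rfl⟩
    have hp : 0 < x ^ n := pow_pos hx0 n
    have hp1 : x ^ n < 1 := pow_lt_one₀ hx0.le hx1 hn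
    refine ⟨by positivity, ?_⟩
    simp only
    rw [div_lt_iff₀ (by positivity)]
    linarith
  · rintro ⟨hu0, hu1⟩
    have hu : 0 < 1 - u := by linarith
    have hpos : 0 < u / (1 - u) := div_pos hu0 hu
    have hlt : u / (1 - u) < 1 := by rw [div_lt_one hu]; linarith
    refine ⟨(u / (1 - u)) ^ (n : ℝ)⁻¹, ⟨by positivity,
      Real.rpow_lt_one hpos.le hlt (by positivity)⟩, ?_⟩
    simp only [Real.rpow_inv_natCast_pow hpos.le hn]
    field_simp
    ring

lemma injOn_pow_div_one_add_pow {n : ℕ} (hn : n ≠ 0) :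
    Set.InjOn (fun x : ℝ => x ^ n / (1 + x ^ n)) (Set.Ioo 0 1) := by
  intro x hx y hy hxy
  have hx' : 0 < x ^ n := pow_pos hx.1 n
  have hy' : 0 < y ^ n := pow_pos hy.1 n
  simp only at hxy
  rw [div_eq_div_iff (by positivity) (by positivity)] at hxy
  exact (pow_left_inj₀ hx.1.le hy.1.le hn).1 (by linarith)

lemma hasDerivAt_pow_div_one_add_pow {n : ℕ} {x : ℝ} (hx : 0 < x) :
    HasDerivAt (fun x : ℝ => x ^ n / (1 + x ^ n)) (n * x ^ (n - 1) / (1 + x ^ n) ^ 2) x := by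
  have hp : 0 < x ^ n := pow_pos hx n
  have h := (hasDerivAt_pow n x).fun_div ((hasDerivAt_pow n x).const_add 1)
    (by positivity : 1 + x ^ n ≠ 0)
  rwa [show n * x ^ (n - 1) * (1 + x ^ n) - x ^ n * (n * x ^ (n - 1)) = n * x ^ (n - 1) by ring]
    at h

lemma integral_beta_half_eq {n l : ℕ} (hl : 1 ≤ l) (hln : l < n) :
    ∫ u in (0 : ℝ)..(1 / 2), u ^ ((l / n : ℝ) - 1) * (1 - u) ^ (-(l / n : ℝ))
      = ∫ x in (0 : ℝ)..1, n * (x ^ (l - 1) / (1 + x ^ n)) := by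
  have hn : n ≠ 0 := by omega
  have hnR : (n : ℝ) ≠ 0 := by exact_mod_cast hn
  rw [integral_of_le (by norm_num), integral_of_le zero_le_one, integral_Ioc_eq_integral_Ioo,
    integral_Ioc_eq_integral_Ioo, ← image_pow_div_one_add_pow hn,
    integral_image_eq_integral_abs_deriv_smul measurableSet_Ioo
      (fun x hx => (hasDerivAt_pow_div_one_add_pow hx.1).hasDerivWithinAt)
      (injOn_pow_div_one_add_pow hn)]
  refine setIntegral_congr_fun measurableSet_Ioo fun x hx => ?_
  have hx0 : 0 < x := hx.1
  have hq : 0 < 1 + x ^ n := by positivity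
  have hsub : 1 - x ^ n / (1 + x ^ n) = (1 + x ^ n)⁻¹ := by field_simp; ring
  simp only [smul_eq_mul]
  rw [abs_of_nonneg (by positivity), hsub, Real.div_rpow (by positivity) hq.le,
    Real.inv_rpow hq.le, Real.rpow_neg hq.le, inv_inv, Real.rpow_sub_one hq.ne',
    ← Real.rpow_natCast_mul hx0.le, mul_sub, mul_div_cancel₀ _ hnR, mul_one,
    Real.rpow_sub hx0, Real.rpow_natCast, Real.rpow_natCast]
  obtain ⟨k, rfl⟩ : ∃ k, l = k + 1 := ⟨l - 1, by omega⟩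
  obtain ⟨m, rfl⟩ : ∃ m, n = m + 1 := ⟨n - 1, by omega⟩
  simp only [Nat.add_sub_cancel] at *
  field_simp
  ring

lemma continuousOn_pow_div_one_add_pow (k n : ℕ) :
    ContinuousOn (fun x : ℝ => x ^ k / (1 + x ^ n)) (Set.uIcc 0 1) := by
  refine ContinuousOn.div (by fun_prop) (by fun_prop) fun x hx => ?_
  rw [Set.uIcc_of_le zero_le_one] at hx
  have := pow_nonneg hx.1 n
  positivity

lemma intervalIntegrable_pow_div_one_add_pow (k n : ℕ) :
    IntervalIntegrable (fun x : ℝ => x ^ k / (1 + x ^ n)) volume 0 1 :=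
  (continuousOn_pow_div_one_add_pow k n).intervalIntegrable

/-- `π csc (π l / n)` as the integral over `[0, ∞)` of `n xˡ⁻¹ / (1 + xⁿ)`, folded to `[0, 1]`. -/
lemma pi_div_sin_eq_integral {n l : ℕ} (hl : 1 ≤ l) (hln : l < n) :
    π / Real.sin (π * l / n) = n * ((∫ x in (0 : ℝ)..1, x ^ (l - 1) / (1 + x ^ n))
      + ∫ x in (0 : ℝ)..1, x ^ (n - l - 1) / (1 + x ^ n)) := by
  have hn : (0 : ℝ) < n := by exact_mod_cast (by omega : 0 < n)
  have h0 : (0 : ℝ) < l / n := div_pos (by exact_mod_cast hl) hn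
  have h1 : (l / n : ℝ) < 1 := by rw [div_lt_one hn]; exact_mod_cast hln
  have hint := intervalIntegrable_beta_one_sub h0 h1
  have hmem : (1 / 2 : ℝ) ∈ Set.uIcc (0 : ℝ) 1 := by
    rw [Set.uIcc_of_le zero_le_one]; norm_num
  have hright : ∫ u in (1 / 2 : ℝ)..1, u ^ ((l / n : ℝ) - 1) * (1 - u) ^ (-(l / n : ℝ))
      = ∫ u in (0 : ℝ)..(1 / 2),
          u ^ (((n - l : ℕ) / n : ℝ) - 1) * (1 - u) ^ (-((n - l : ℕ) / n : ℝ)) := by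
    have h := integral_comp_sub_left (a := 0) (b := 1 / 2)
      (fun u : ℝ => u ^ ((l / n : ℝ) - 1) * (1 - u) ^ (-(l / n : ℝ))) 1
    norm_num at h ⊢
    rw [← h]
    have hq : ((n - l : ℕ) / n : ℝ) = 1 - l / n := by
      rw [Nat.cast_sub hln.le, sub_div, div_self hn.ne']
    rw [hq]
    refine integral_congr fun u _ => ?_
    rw [mul_comm]
    ring_nf
  rw [mul_div_assoc, ← integral_beta_one_sub h0 h1,
    ← integral_add_adjacent_intervals
      (hint.mono_set (Set.uIcc_subset_uIcc_left hmem))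
      (hint.mono_set (Set.uIcc_subset_uIcc_right hmem)),
    hright, integral_beta_half_eq hl hln, integral_beta_half_eq (by omega) (by omega),
    intervalIntegral.integral_const_mul, intervalIntegral.integral_const_mul, mul_add]

lemma cos_two_pi_mul_div_lt_one {n ν : ℕ} (hν1 : 1 ≤ ν) (hνn : ν < n) :
    Real.cos (2 * π * ν / n) < 1 := by
  have hn : (0 : ℝ) < n := by exact_mod_cast (by omega : 0 < n)
  have hν : (0 : ℝ) < ν := by exact_mod_cast hν1
  refine lt_of_le_of_ne (Real.cos_le_one _) fun h => ?_
  have hlt : (2 * π * ν / n : ℝ) < 2 * π := by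
    rw [div_lt_iff₀ hn]
    exact mul_lt_mul_of_pos_left (by exact_mod_cast hνn) (by positivity)
  have hpos : (0 : ℝ) < 2 * π * ν / n := by positivity
  exact hpos.ne' ((Real.cos_eq_one_iff_of_lt_of_lt (by linarith) hlt).1 h)

/-- The integrand of the representation is a trigonometric sum of monomials over `1 + xⁿ`. -/
lemma sum_cos_mul_pow_div_eq {n ν : ℕ} (hν1 : 1 ≤ ν) (hνn : ν < n) {x : ℝ} (hx : 0 ≤ x) :
    ∑ l ∈ Finset.range (n - 1), Real.cos ((l + 1) * (2 * π * ν / n)) * (x ^ l / (1 + x ^ n))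
      = ((1 + x ^ n) * Real.cos (2 * π * ν / n) - x ^ (n - 1) - x)
            / ((1 + x ^ n) * (x ^ 2 - 2 * x * Real.cos (2 * π * ν / n) + 1)) := by
  have hc := cos_two_pi_mul_div_lt_one hν1 hνn
  have hq : 0 < x ^ 2 - 2 * x * Real.cos (2 * π * ν / n) + 1 := by
    rcases hx.eq_or_lt with rfl | hx
    · norm_num
    · nlinarith [sq_nonneg (x - 1), mul_pos hx (sub_pos.2 hc)]
  have hp : 0 < 1 + x ^ n := by positivity
  have hsum := sum_cos_mul_pow_mul_quadratic (2 * π * ν / n) x (n - 1)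
  obtain ⟨m, rfl⟩ : ∃ m, n = m + 1 := ⟨n - 1, by omega⟩
  have hm : ((m + 1 : ℕ) : ℝ) ≠ 0 := by positivity
  have htop : Real.cos ((m + 1) * (2 * π * ν / (m + 1 : ℕ))) = 1 := by
    rw [← Nat.cast_add_one, mul_div_cancel₀ _ hm, mul_comm, Real.cos_nat_mul_two_pi]
  have hlast : Real.cos (m * (2 * π * ν / (m + 1 : ℕ))) = Real.cos (2 * π * ν / (m + 1 : ℕ)) := by
    rw [← Real.cos_nat_mul_two_pi_sub _ ν]
    congr 1
    push_cast at hm ⊢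
    field_simp
    ring
  simp only [Nat.add_sub_cancel] at hsum ⊢
  rw [htop, hlast] at hsum
  simp only [← mul_div_assoc (Real.cos _)]
  rw [← Finset.sum_div, div_eq_div_iff hp.ne' (by positivity)]
  linear_combination (1 + x ^ (m + 1)) * hsum

theorem C_integral_rep (n : ℕ) (hn : 2 ≤ n) (ν : ℕ) (hν1 : 1 ≤ ν) (hν2 : ν ≤ n - 1) :
    C n (ν : ℤ)
      = (2 * n / π) * ∫ x in (0 : ℝ)..1,
          ((1 + x ^ n) * Real.cos (2 * π * ν / n) - x ^ (n - 1) - x)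
            / ((1 + x ^ n) * (x ^ 2 - 2 * x * Real.cos (2 * π * ν / n) + 1)) := by
  have hνn : ν < n := by omega
  have hn0 : (n : ℝ) ≠ 0 := by positivity
  set θ : ℝ := 2 * π * ν / n with hθ
  set I : ℕ → ℝ := fun k => ∫ x in (0 : ℝ)..1, x ^ k / (1 + x ^ n) with hI
  have hC : C n (ν : ℤ) = ∑ k ∈ Finset.range (n - 1),
      (n / π) * (Real.cos ((k + 1) * θ) * I k + Real.cos ((k + 1) * θ) * I (n - 1 - 1 - k)) := by
    rw [C, show Finset.Icc 1 (n - 1) = Finset.Ico 1 n by ext; simp; omega,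
      Finset.sum_Ico_eq_sum_range]
    refine Finset.sum_congr rfl fun k hk => ?_
    have hk' := Finset.mem_range.1 hk
    have h := pi_div_sin_eq_integral (n := n) (l := 1 + k) (by omega) (by omega)
    rw [show 1 + k - 1 = k by omega, show n - (1 + k) - 1 = n - 1 - 1 - k by omega] at h
    rw [← mul_add, mul_left_comm, div_mul_eq_mul_div, ← h, div_div_cancel_left' Real.pi_ne_zero,
      div_eq_mul_inv]
    congr 2
    rw [hθ]
    push_cast
    ring
  have hreflect : ∑ k ∈ Finset.range (n - 1), Real.cos ((k + 1) * θ) * I (n - 1 - 1 - k)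
      = ∑ k ∈ Finset.range (n - 1), Real.cos ((k + 1) * θ) * I k := by
    rw [← Finset.sum_range_reflect]
    refine Finset.sum_congr rfl fun k hk => ?_
    have hk' := Finset.mem_range.1 hk
    have hidx : n - 1 - 1 - (n - 1 - 1 - k) = k := by omega
    have hcast : ((n - 1 - 1 - k : ℕ) : ℝ) = n - 2 - k := by
      rw [eq_sub_iff_add_eq, eq_sub_iff_add_eq]
      exact_mod_cast (by omega : n - 1 - 1 - k + k + 2 = n)
    rw [hidx, hcast, ← Real.cos_nat_mul_two_pi_sub ((k + 1) * θ) ν]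
    congr 2
    rw [hθ]
    field_simp
    ring
  rw [hC, ← Finset.mul_sum, Finset.sum_add_distrib, hreflect, ← two_mul, ← mul_assoc,
    div_mul_eq_mul_div, mul_comm (n : ℝ) 2]
  congr 1
  rw [← integral_congr (f := fun x : ℝ => ∑ k ∈ Finset.range (n - 1),
      Real.cos ((k + 1) * θ) * (x ^ k / (1 + x ^ n))) fun x hx =>
        sum_cos_mul_pow_div_eq hν1 hνn (by rw [Set.uIcc_of_le zero_le_one] at hx; exact hx.1),
    intervalIntegral.integral_finsetSum fun k _ =>
      (intervalIntegrable_pow_div_one_add_pow k n).const_mul _]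
  simp only [intervalIntegral.integral_const_mul, hI]
end

section
/- For every integer n ≥ 2 and every integer ν with 1 ≤ ν ≤ n − 1 and 2ν ≠ n, C_n(ν) = (n − 2ν)·cot(2πν/n) − (n/π) · ∫₀^∞ cosh(x·(n/2 − 1)) / [ cosh(xn/2)·(cosh x − cos(2πν/n)) ] dx. -/
open Real Finset

open MeasureTheory Filter Topology

/-- The Beta integral `B(u, 1 - u)`, transported to `ℝ` by the sigmoid function. -/
lemma integral_exp_mul_div_one_add_exp {u : ℝ} (h0 : 0 < u) (h1 : u < 1) :
    ∫ y : ℝ, exp (u * y) / (1 + exp y) = π / sin (π * u) := by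
  have hbeta : ∫ x in Set.Ioo (0 : ℝ) 1, x ^ (u - 1) * (1 - x) ^ ((1 - u) - 1)
      = π / sin (π * u) := by
    have h := ProbabilityTheory.beta_eq_betaIntegralReal u (1 - u) h0 (by linarith)
    rw [ProbabilityTheory.beta, add_sub_cancel, Real.Gamma_one, div_one,
      Real.Gamma_mul_Gamma_one_sub] at h
    rw [h, Complex.betaIntegral, intervalIntegral.integral_of_le zero_le_one,
      integral_Ioc_eq_integral_Ioo, ← Complex.ofReal_re (∫ x in _, _), ← integral_complex_ofReal]
    congr 1
    refine setIntegral_congr_fun measurableSet_Ioo fun x hx => ?_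
    have hx' : 0 ≤ 1 - x := by linarith [hx.2]
    push_cast [Complex.ofReal_cpow hx.1.le, Complex.ofReal_cpow hx']
    rfl
  rw [← hbeta, ← range_sigmoid, ← Set.image_univ,
    integral_image_eq_integral_abs_deriv_smul MeasurableSet.univ
      (fun x _ => (hasDerivAt_sigmoid x).hasDerivWithinAt) sigmoid_injective.injOn,
    Measure.restrict_univ]
  congr 1
  ext y
  have hs := sigmoid_pos y
  have hs' : 0 < 1 - sigmoid y := by linarith [sigmoid_lt_one y]
  rw [abs_of_pos (mul_pos hs hs'), smul_eq_mul, Real.rpow_sub_one hs.ne',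
    Real.rpow_sub_one hs'.ne', Real.rpow_sub hs', Real.rpow_one]
  have hq : sigmoid y = (1 - sigmoid y) * exp y := by
    rw [← sigmoid_neg, ← sigmoid_mul_rexp_neg, mul_assoc, ← exp_add]; simp
  have hq' : 1 - sigmoid y = 1 / (1 + exp y) := by
    rw [eq_div_iff (by positivity)]; linarith
  have hpow : sigmoid y ^ u = (1 - sigmoid y) ^ u * exp (u * y) := by
    conv_lhs => rw [hq]
    rw [Real.mul_rpow hs'.le (exp_pos y).le, ← exp_mul, mul_comm y]
  have hp : 0 < (1 - sigmoid y) ^ u := Real.rpow_pos_of_pos hs' u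
  rw [hpow]
  field_simp
  rw [hq']
  field_simp

lemma sin_pi_mul_pos {u : ℝ} (h0 : 0 < u) (h1 : u < 1) : 0 < sin (π * u) :=
  sin_pos_of_pos_of_lt_pi (by positivity) (by nlinarith [pi_pos])

lemma integrable_exp_mul_div_one_add_exp {u : ℝ} (h0 : 0 < u) (h1 : u < 1) :
    Integrable fun y : ℝ => exp (u * y) / (1 + exp y) :=
  Integrable.of_integral_ne_zero <| by
    rw [integral_exp_mul_div_one_add_exp h0 h1]
    exact (div_pos pi_pos (sin_pi_mul_pos h0 h1)).ne'

lemma integral_Ioi_cosh_div_cosh {u : ℝ} (h0 : 0 < u) (h1 : u < 1) :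
    ∫ y in Set.Ioi (0 : ℝ), cosh ((u - 1 / 2) * y) / cosh (y / 2) = π / sin (π * u) := by
  have hint := integrable_exp_mul_div_one_add_exp h0 h1
  have hfold : ∫ y : ℝ, cosh ((u - 1 / 2) * y) / cosh (y / 2) = 2 * (π / sin (π * u)) := by
    have hneg := integral_neg_eq_self (fun y => exp (u * y) / (1 + exp y)) volume
    rw [← integral_exp_mul_div_one_add_exp h0 h1, two_mul]
    nth_rewrite 2 [← hneg]
    rw [← integral_add hint hint.comp_neg]
    congr 1
    ext y
    have e1 : exp (u * y) = exp ((u - 1 / 2) * y) * exp (y / 2) := by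
      rw [← exp_add]; ring_nf
    have e2 : exp y = exp (y / 2) ^ 2 := by rw [← exp_nat_mul]; push_cast; ring_nf
    have e3 : exp (u * -y) = (exp ((u - 1 / 2) * y))⁻¹ * (exp (y / 2))⁻¹ := by
      rw [← exp_neg, ← exp_neg, ← exp_add]; ring_nf
    rw [exp_neg y, e1, e3, e2, cosh_eq, cosh_eq, exp_neg, exp_neg]
    have := exp_pos ((u - 1 / 2) * y)
    have := exp_pos (y / 2)
    field_simp
    ring
  have habs := integral_comp_abs (f := fun y : ℝ => cosh ((u - 1 / 2) * y) / cosh (y / 2))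
  have heven : ∀ y : ℝ, cosh ((u - 1 / 2) * |y|) / cosh (|y| / 2)
      = cosh ((u - 1 / 2) * y) / cosh (y / 2) := fun y => by
    rcases abs_choice y with h | h <;> rw [h]
    rw [mul_neg, neg_div, cosh_neg, cosh_neg]
  simp only [heven] at habs
  linarith

lemma integral_Ioi_cosh_sub_mul_div_cosh {n l : ℝ} (hl : 0 < l) (hln : l < n) :
    ∫ x in Set.Ioi (0 : ℝ), cosh ((l - n / 2) * x) / cosh (n * x / 2)
      = π / (n * sin (π * l / n)) := by
  have hn : 0 < n := hl.trans hln
  have h := integral_comp_mul_left_Ioi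
    (fun y => cosh ((l / n - 1 / 2) * y) / cosh (y / 2)) 0 hn
  rw [mul_zero, integral_Ioi_cosh_div_cosh (div_pos hl hn) ((div_lt_one hn).2 hln),
    smul_eq_mul] at h
  have e : ∀ x, (l / n - 1 / 2) * (n * x) = (l - n / 2) * x := fun x => by field_simp
  simp only [e] at h
  rw [h, mul_div_assoc, inv_mul_eq_div, div_div, mul_comm n]

lemma integrableOn_Ioi_cosh_sub_mul_div_cosh {n l : ℝ} (hl : 0 < l) (hln : l < n) :
    IntegrableOn (fun x => cosh ((l - n / 2) * x) / cosh (n * x / 2)) (Set.Ioi 0) :=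
  Integrable.of_integral_ne_zero <| by
    have hn : 0 < n := hl.trans hln
    rw [integral_Ioi_cosh_sub_mul_div_cosh hl hln, mul_div_assoc]
    exact (div_pos pi_pos
      (mul_pos hn (sin_pi_mul_pos (div_pos hl hn) ((div_lt_one hn).2 hln)))).ne'

lemma cosh_sub_cos_pos {a : ℝ} (ha : sin a ≠ 0) (x : ℝ) : 0 < cosh x - cos a := by
  have : cos a ≠ 1 := fun h => ha (by nlinarith [sin_sq_add_cos_sq a])
  linarith [one_le_cosh x, lt_of_le_of_ne (cos_le_one a) this]

lemma integral_Ioi_one_div_cosh_sub_cos_of_lt_pi {a : ℝ} (h0 : 0 < a) (h1 : a < π) :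
    ∫ x in Set.Ioi (0 : ℝ), 1 / (cosh x - cos a) = (π - a) / sin a := by
  have hs : 0 < sin a := sin_pos_of_pos_of_lt_pi h0 h1
  have hderiv : ∀ x ∈ Set.Ici (0 : ℝ),
      HasDerivAt (fun x => 2 / sin a * arctan ((exp x - cos a) / sin a))
        (1 / (cosh x - cos a)) x := fun x _ => by
    have hD := cosh_sub_cos_pos hs.ne' x
    refine ((((Real.hasDerivAt_exp x).sub_const (cos a)).div_const (sin a)).arctan.const_mul
      (2 / sin a)).congr_deriv ?_
    have hx := exp_pos x
    have hD' : exp x ^ 2 - 2 * exp x * cos a + 1 = 2 * exp x * (cosh x - cos a) := by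
      rw [cosh_eq, exp_neg]; field_simp; ring
    have hD'' : 1 + ((exp x - cos a) / sin a) ^ 2
        = 2 * exp x * (cosh x - cos a) / sin a ^ 2 := by
      rw [← hD']; field_simp; linarith [sin_sq_add_cos_sq a]
    rw [hD'']
    field_simp
  have hlim : Tendsto (fun x => 2 / sin a * arctan ((exp x - cos a) / sin a)) atTop
      (𝓝 (2 / sin a * (π / 2))) :=
    ((tendsto_arctan_atTop.mono_right nhdsWithin_le_nhds).comp
      ((tendsto_atTop_add_const_right _ (-cos a) tendsto_exp_atTop).atTop_div_const hs)).const_mul _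
  rw [integral_Ioi_of_hasDerivAt_of_nonneg' hderiv
    (fun x _ => (one_div_pos.2 (cosh_sub_cos_pos hs.ne' x)).le) hlim]
  have hhalf : (exp 0 - cos a) / sin a = tan (a / 2) := by
    have hc : 0 < cos (a / 2) := cos_pos_of_mem_Ioo ⟨by linarith, by linarith⟩
    have e : a = 2 * (a / 2) := by ring
    have hs2 : 0 < sin (a / 2) := sin_pos_of_pos_of_lt_pi (by linarith) (by linarith)
    rw [exp_zero, tan_eq_sin_div_cos]
    nth_rewrite 1 2 [e]
    rw [cos_two_mul, sin_two_mul]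
    field_simp
    linarith [sin_sq_add_cos_sq (a / 2)]
  rw [hhalf, arctan_tan (by linarith) (by linarith)]
  field_simp

lemma integral_Ioi_one_div_cosh_sub_cos {a : ℝ} (h0 : 0 < a) (h2 : a < 2 * π) (hpi : a ≠ π) :
    ∫ x in Set.Ioi (0 : ℝ), 1 / (cosh x - cos a) = (π - a) / sin a := by
  rcases hpi.lt_or_gt with h | h
  · exact integral_Ioi_one_div_cosh_sub_cos_of_lt_pi h0 h
  · have := integral_Ioi_one_div_cosh_sub_cos_of_lt_pi (a := 2 * π - a) (by linarith) (by linarith)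
    rw [cos_two_pi_sub, sin_two_pi_sub] at this
    rw [this, div_neg, ← neg_div]
    ring_nf

lemma sum_pow_mul_cos (r a : ℝ) (m : ℕ) :
    (r ^ 2 - 2 * r * cos a + 1) * ∑ l ∈ range m, r ^ l * cos (a * l)
      = 1 - r * cos a - r ^ m * cos (a * m)
        + r ^ (m + 1) * (cos (a * m) * cos a + sin (a * m) * sin a) := by
  induction m with
  | zero => simp
  | succ m ih =>
    rw [sum_range_succ, mul_add, ih]
    have e : a * (m + 1 : ℕ) = a * m + a := by push_cast; ring
    rw [e, cos_add, sin_add]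
    linear_combination (-r ^ (m + 2) * cos (a * m)) * sin_sq_add_cos_sq a

lemma sum_cos_mul_cosh {a : ℝ} {n : ℕ} (hcos : cos (a * n) = 1) (x : ℝ) :
    (cosh x - cos a) * ∑ l ∈ range n, cos (a * l) * cosh (((l : ℝ) - n / 2) * x)
      = sinh (n * x / 2) * sinh x := by
  have hsin : sin (a * n) = 0 := by
    have := sin_sq_add_cos_sq (a * n)
    rw [hcos] at this
    exact pow_eq_zero_iff two_ne_zero |>.1 (by linarith)
  have key (y : ℝ) : 2 * (cosh y - cos a) * ∑ l ∈ range n, exp y ^ l * cos (a * l)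
      = (1 - exp y ^ n) * (exp (-y) - cos a) := by
    have h := sum_pow_mul_cos (exp y) a n
    rw [hcos, hsin] at h
    have hy := exp_pos y
    have hD : exp y ^ 2 - 2 * exp y * cos a + 1 = exp y * (2 * (cosh y - cos a)) := by
      rw [cosh_eq, exp_neg]; field_simp; ring
    rw [hD, mul_assoc] at h
    refine mul_left_cancel₀ hy.ne' (h.trans ?_)
    rw [exp_neg]
    field_simp
    ring
  have hsum : 2 * ∑ l ∈ range n, cos (a * l) * cosh (((l : ℝ) - n / 2) * x)
      = exp (-(n * x / 2)) * ∑ l ∈ range n, exp x ^ l * cos (a * l)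
        + exp (n * x / 2) * ∑ l ∈ range n, exp (-x) ^ l * cos (a * l) := by
    rw [mul_sum, mul_sum, mul_sum, ← sum_add_distrib]
    refine sum_congr rfl fun l _ => ?_
    have e1 : exp (((l : ℝ) - n / 2) * x) = exp (-(n * x / 2)) * exp x ^ l := by
      rw [← exp_nat_mul, ← exp_add]; ring_nf
    have e2 : exp (-(((l : ℝ) - n / 2) * x)) = exp (n * x / 2) * exp (-x) ^ l := by
      rw [← exp_nat_mul, ← exp_add]; ring_nf
    rw [cosh_eq, e1, e2]
    ring
  have k1 := key x
  have k2 := key (-x)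
  rw [cosh_neg, neg_neg] at k2
  have p1 : exp x ^ n = exp (n * x / 2) ^ 2 := by
    rw [← exp_nat_mul, ← exp_nat_mul]; push_cast; ring_nf
  have p2 : exp (-x) ^ n = exp (-(n * x / 2)) ^ 2 := by
    rw [← exp_nat_mul, ← exp_nat_mul]; push_cast; ring_nf
  have p3 : exp (-(n * x / 2)) * exp (n * x / 2) = 1 := by rw [← exp_add]; simp
  rw [p1] at k1
  rw [p2] at k2
  rw [sinh_eq, sinh_eq]
  linear_combination (cosh x - cos a) / 2 * hsum + exp (-(n * x / 2)) / 4 * k1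
    + exp (n * x / 2) / 4 * k2
    - (exp (n * x / 2) * (exp (-x) - cos a) + exp (-(n * x / 2)) * (exp x - cos a)) / 4 * p3

theorem C_integral_rep' (n : ℕ) (hn : 2 ≤ n) (ν : ℕ) (hν1 : 1 ≤ ν) (hν2 : ν ≤ n - 1)
    (hν3 : 2 * ν ≠ n) :
    C n (ν : ℤ)
      = ((n : ℝ) - 2 * ν) * Real.cot (2 * π * ν / n)
        - ((n : ℝ) / π) * ∫ x in Set.Ioi (0 : ℝ),
            Real.cosh (x * ((n : ℝ) / 2 - 1))
              / (Real.cosh (x * n / 2) * (Real.cosh x - Real.cos (2 * π * ν / n))) := by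
  have hn0 : (0 : ℝ) < n := by positivity
  have hνn : ν < n := by omega
  have hν0 : (0 : ℝ) < ν := by exact_mod_cast hν1
  have hνn' : (ν : ℝ) < n := by exact_mod_cast hνn
  set a : ℝ := 2 * π * ν / n with ha
  have ha0 : 0 < a := by positivity
  have ha2 : a < 2 * π := by rw [ha, div_lt_iff₀ hn0]; gcongr
  have haπ : a ≠ π := fun h => hν3 <| by
    rw [ha, div_eq_iff hn0.ne', mul_comm 2 π, mul_assoc] at h
    exact_mod_cast mul_left_cancel₀ pi_ne_zero h
  have hsin : sin a ≠ 0 := fun h => by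
    rcases haπ.lt_or_gt with h' | h'
    · exact (sin_pos_of_pos_of_lt_pi ha0 h').ne' h
    · have := sin_pos_of_pos_of_lt_pi (x := a - π) (by linarith) (by linarith)
      rw [sin_sub_pi, h] at this
      simp at this
  have hcos : cos (a * n) = 1 := by
    rw [ha, div_mul_cancel₀ _ hn0.ne', mul_comm]
    exact cos_nat_mul_two_pi ν
  have hA := integral_Ioi_one_div_cosh_sub_cos ha0 ha2 haπ
  have hAint : IntegrableOn (fun x => 1 / (cosh x - cos a)) (Set.Ioi 0) :=
    Integrable.of_integral_ne_zero <| by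
      rw [hA]
      exact div_ne_zero (sub_ne_zero.2 haπ.symm) hsin
  have hmem : ∀ l ∈ Icc 1 (n - 1), (0 : ℝ) < l ∧ (l : ℝ) < n := fun l hl => by
    rw [mem_Icc] at hl
    exact ⟨by exact_mod_cast hl.1, by exact_mod_cast (by omega : l < n)⟩
  have hterm : ∀ l ∈ Icc 1 (n - 1), IntegrableOn
      (fun x => cos (a * l) * (cosh (((l : ℝ) - n / 2) * x) / cosh (n * x / 2)))
      (Set.Ioi 0) := fun l hl =>
    (integrableOn_Ioi_cosh_sub_mul_div_cosh (hmem l hl).1 (hmem l hl).2).const_mul _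
  have hC : C n ν = n / π * ∫ x in Set.Ioi (0 : ℝ), ∑ l ∈ Icc 1 (n - 1),
      cos (a * l) * (cosh (((l : ℝ) - n / 2) * x) / cosh (n * x / 2)) := by
    rw [integral_finsetSum _ hterm, mul_sum, C]
    refine sum_congr rfl fun l hl => ?_
    rw [integral_const_mul, integral_Ioi_cosh_sub_mul_div_cosh (hmem l hl).1 (hmem l hl).2]
    have : a * l = 2 * π * ν * l / n := by rw [ha]; ring
    rw [this]
    push_cast
    field_simp
  have hrange : range n = insert 0 (Icc 1 (n - 1)) := by
    ext l; simp only [mem_range, mem_insert, mem_Icc]; omega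
  have hpoint : ∀ x : ℝ, cosh (x * ((n : ℝ) / 2 - 1)) / (cosh (x * n / 2) * (cosh x - cos a))
      = cos a * (1 / (cosh x - cos a)) - ∑ l ∈ Icc 1 (n - 1),
      cos (a * l) * (cosh (((l : ℝ) - n / 2) * x) / cosh (n * x / 2)) := fun x => by
    have h := sum_cos_mul_cosh hcos x
    rw [hrange, sum_insert (by simp)] at h
    have e0 : cosh (((0 : ℕ) - (n : ℝ) / 2) * x) = cosh (n * x / 2) := by
      rw [← cosh_neg]; push_cast; ring_nf
    have e1 : cosh (x * ((n : ℝ) / 2 - 1))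
        = cosh (n * x / 2) * cosh x - sinh (n * x / 2) * sinh x := by
      rw [← cosh_sub]; ring_nf
    rw [e0] at h
    simp only [Nat.cast_zero, mul_zero, cos_zero, one_mul] at h
    simp only [← mul_div_assoc]
    rw [← sum_div, e1, mul_comm x n]
    generalize ∑ l ∈ Icc 1 (n - 1), cos (a * l) * cosh (((l : ℝ) - n / 2) * x) = S at h ⊢
    have hD := cosh_sub_cos_pos hsin x
    have hc := cosh_pos (n * x / 2)
    field_simp
    linear_combination h
  simp only [hpoint]
  rw [integral_sub (hAint.const_mul _) (integrable_finsetSum _ hterm), integral_const_mul, hA, hC,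
    Real.cot_eq_cos_div_sin]
  have hnν : (n : ℝ) - 2 * ν = n / π * (π - a) := by rw [ha]; field_simp
  rw [hnν]
  generalize ∫ x in Set.Ioi (0 : ℝ), ∑ l ∈ Icc 1 (n - 1),
    cos (a * l) * (cosh (((l : ℝ) - n / 2) * x) / cosh (n * x / 2)) = I
  field_simp
  ring
end

section
/- For every integer n ≥ 2 and every integer k, the series Σ_{r=1}^∞ C_n(rk)/(4r² − 1) converges absolutely, and Σ_{l=1}^{n−1} |sin(πlk/n)|·csc(πl/n) = (2/π)·S_n − (4/π)·Σ_{r=1}^∞ C_n(rk)/(4r² − 1). -/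
open Real Finset

/-- The `π`-periodic function `|sin x|`, as a continuous complex-valued function on `ℝ / πℤ`. -/
noncomputable def absSinCircle : C(AddCircle π, ℂ) where
  toFun := Function.Periodic.lift (f := fun x : ℝ => ((|Real.sin x| : ℝ) : ℂ)) (c := π)
    (fun x => by simp [Real.sin_add_pi])
  continuous_toFun := continuous_coinduced_dom.mpr (by
    change Continuous (fun x : ℝ => ((|Real.sin x| : ℝ) : ℂ))
    fun_prop)

theorem absSinCircle_coe (x : ℝ) : absSinCircle (x : AddCircle π) = ((|Real.sin x| : ℝ) : ℂ) :=
  rfl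

theorem one_sub_four_mul_sq_ne_zero (m : ℤ) : (1 - 4 * (m : ℂ) ^ 2) ≠ 0 := by
  have h : (1 - 4 * m ^ 2 : ℤ) ≠ 0 := by omega
  exact_mod_cast h

theorem integral_exp_mul_sin (m : ℤ) :
    ∫ x in (0 : ℝ)..π, Complex.exp (-(2 * Complex.I * m) * x) * Complex.sin x
      = 2 / (1 - 4 * (m : ℂ) ^ 2) := by
  have hne := one_sub_four_mul_sq_ne_zero m
  set a : ℂ := -(2 * Complex.I * m) with ha
  have ha2 : a ^ 2 + 1 = 1 - 4 * (m : ℂ) ^ 2 := by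
    rw [ha]; ring_nf; rw [Complex.I_sq]; ring
  have hderiv : ∀ x ∈ Set.uIcc (0 : ℝ) π, HasDerivAt
      (fun x : ℝ => Complex.exp (a * x) * (a * Complex.sin x - Complex.cos x) / (a ^ 2 + 1))
      (Complex.exp (a * x) * Complex.sin x) x := by
    intro x _
    have h1 : HasDerivAt (fun z : ℂ => Complex.exp (a * z)) (Complex.exp (a * x) * (a * 1)) x :=
      ((hasDerivAt_id (x : ℂ)).const_mul a).cexp
    have h2 := ((Complex.hasDerivAt_sin x).const_mul a).sub (Complex.hasDerivAt_cos x)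
    convert! ((h1.mul h2).div_const (a ^ 2 + 1)).comp_ofReal using 1
    rw [← ha2] at hne
    simp only [Pi.sub_apply]
    field_simp
    ring
  rw [intervalIntegral.integral_eq_sub_of_hasDerivAt hderiv
    (Continuous.intervalIntegrable (by fun_prop) _ _), ha2]
  have hexp : Complex.exp (a * (π : ℝ)) = 1 := by
    rw [Complex.exp_eq_one_iff]
    exact ⟨-m, by rw [ha]; push_cast; ring⟩
  rw [hexp]
  simp
  ring

theorem fourierCoeff_absSinCircle [Fact (0 < π)] (m : ℤ) :
    fourierCoeff absSinCircle m = (2 / π) / (1 - 4 * (m : ℂ) ^ 2) := by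
  have hpi : (π : ℂ) ≠ 0 := by exact_mod_cast Real.pi_ne_zero
  rw [fourierCoeff_eq_intervalIntegral _ _ 0, zero_add]
  have h : ∫ x in (0 : ℝ)..π, fourier (-m) (x : AddCircle π) • absSinCircle (x : AddCircle π)
      = ∫ x in (0 : ℝ)..π, Complex.exp (-(2 * Complex.I * m) * x) * Complex.sin x := by
    refine intervalIntegral.integral_congr fun x hx => ?_
    rw [Set.uIcc_of_le Real.pi_pos.le] at hx
    simp only [absSinCircle_coe, fourier_coe_apply, smul_eq_mul,
      abs_of_nonneg (Real.sin_nonneg_of_mem_Icc hx), Complex.ofReal_sin]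
    congr 2
    push_cast
    field_simp
  rw [h, integral_exp_mul_sin, Complex.real_smul]
  push_cast
  ring

theorem summable_fourierCoeff_absSinCircle [Fact (0 < π)] :
    Summable (fourierCoeff absSinCircle) := by
  have hs : Summable fun m : ℤ => (2 / π) * (1 / (m : ℝ) ^ 2) :=
    (Real.summable_one_div_int_pow.mpr one_lt_two).mul_left _
  refine .of_norm_bounded_eventually hs ?_
  filter_upwards [(Set.finite_singleton (0 : ℤ)).compl_mem_cofinite] with m hm
  have hm0 : m ≠ 0 := hm
  have h1 : (1 : ℝ) ≤ (m : ℝ) ^ 2 := by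
    have : 1 ≤ m ^ 2 := Int.add_one_le_iff.mpr (sq_pos_iff.mpr hm0)
    exact_mod_cast this
  have hnorm : ‖fourierCoeff absSinCircle m‖ = (2 / π) * (1 / |1 - 4 * (m : ℝ) ^ 2|) := by
    rw [fourierCoeff_absSinCircle,
      show (2 / (π : ℂ)) / (1 - 4 * (m : ℂ) ^ 2)
        = (((2 / π) / (1 - 4 * (m : ℝ) ^ 2) : ℝ) : ℂ) by push_cast; rfl,
      Complex.norm_real, Real.norm_eq_abs, abs_div, abs_of_pos (div_pos two_pos Real.pi_pos)]
    ring
  rw [hnorm, abs_of_neg (by linarith)]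
  have := Real.pi_pos
  gcongr
  linarith

/-- The Fourier series of `|sin x|`. -/
theorem hasSum_cos_two_mul_div (x : ℝ) :
    HasSum (fun r : ℕ => Real.cos (2 * ((r : ℝ) + 1) * x) / (4 * ((r : ℝ) + 1) ^ 2 - 1))
      (1 / 2 - π / 4 * |Real.sin x|) := by
  have : Fact (0 < π) := ⟨Real.pi_pos⟩
  have hpi : (π : ℂ) ≠ 0 := by exact_mod_cast Real.pi_ne_zero
  have h := (has_pointwise_sum_fourier_series_of_summable
    summable_fourierCoeff_absSinCircle (x : AddCircle π)).nat_add_neg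
  have h := ((hasSum_nat_add_iff' 1).mpr h).mul_left (-(π : ℂ) / 4)
  simp only [absSinCircle_coe, fourierCoeff_absSinCircle, fourier_coe_apply, smul_eq_mul] at h
  rw [← Complex.hasSum_ofReal]
  convert! h using 1
  · funext r
    have hne := one_sub_four_mul_sq_ne_zero (r + 1)
    have hne' : (4 * ((r : ℂ) + 1) ^ 2 - 1) ≠ 0 := by
      intro h0; apply hne; push_cast; linear_combination -h0
    push_cast
    rw [Complex.cos,
      show 2 * (π : ℂ) * Complex.I * ((r : ℂ) + 1) * x / π = 2 * ((r : ℂ) + 1) * x * Complex.I by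
        field_simp,
      show 2 * (π : ℂ) * Complex.I * -((r : ℂ) + 1) * x / π
        = -(2 * ((r : ℂ) + 1) * x) * Complex.I by field_simp,
      neg_sq, ← neg_sub (4 * ((r : ℂ) + 1) ^ 2) 1]
    generalize Complex.exp (2 * ((r : ℂ) + 1) * x * Complex.I) = e₁
    generalize Complex.exp (-(2 * ((r : ℂ) + 1) * x) * Complex.I) = e₂
    field_simp
    ring
  · simp
    field_simp
    ring

theorem hasSum_C_div (n : ℕ) (k : ℤ) :
    HasSum (fun r : ℕ => C n (((r : ℤ) + 1) * k) / (4 * ((r : ℝ) + 1) ^ 2 - 1))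
      (∑ l ∈ Finset.Icc 1 (n - 1),
        (1 / 2 - π / 4 * |Real.sin (π * l * k / n)|) / Real.sin (π * l / n)) := by
  have h := hasSum_sum (s := Finset.Icc 1 (n - 1)) fun (l : ℕ) _ =>
    (hasSum_cos_two_mul_div (π * l * k / n)).div_const (Real.sin (π * l / n))
  refine h.congr_fun fun r => ?_
  rw [C, Finset.sum_div]
  refine Finset.sum_congr rfl fun l _ => ?_
  push_cast
  rw [div_right_comm]
  congr 3
  ring

theorem polya_vinogradov_expansion (n : ℕ) (hn : 2 ≤ n) (k : ℤ) :
    Summable (fun r : ℕ => |C n (((r : ℤ) + 1) * k) / (4 * ((r : ℝ) + 1) ^ 2 - 1)|) ∧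
    ∑ l ∈ Finset.Icc 1 (n - 1), |Real.sin (π * l * k / n)| / Real.sin (π * l / n)
      = (2 / π) * S n
        - (4 / π) * ∑' r : ℕ, C n (((r : ℤ) + 1) * k) / (4 * ((r : ℝ) + 1) ^ 2 - 1) := by
  have h := hasSum_C_div n k
  refine ⟨h.summable.abs, ?_⟩
  rw [h.tsum_eq, S, Finset.mul_sum, Finset.mul_sum, ← Finset.sum_sub_distrib]
  refine Finset.sum_congr rfl fun l _ => ?_
  have := Real.pi_ne_zero
  field_simp
  ring
end
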